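/- If n > 1 is primover to base 2, then 2^n − 1 is primover to base 2 if and only if n is prime. -/

import Mathlib

/-- `N` is primover to base 2: `N > 1` and every divisor `d > 1` of `N` has
`ord_d(2) = ord_N(2)`. -/
def Primover2 (N : ℕ) : Prop :=
  1 < N ∧ ∀ d, d ∣ N → 1 < d → orderOf (2 : ZMod d) = orderOf (2 : ZMod N)

theorem pow_eq_one_iff_aux (d k : ℕ) : (2 : ZMod d) ^ k = 1 ↔ d ∣ 2 ^ k - 1 := by
  rw [← ZMod.natCast_eq_zero_iff, Nat.cast_sub Nat.one_le_two_pow]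
  push_cast
  rw [sub_eq_zero]

/-- If `n > 1` is primover to base 2, then `2^n - 1` is primover to base 2 iff `n` is
prime. -/
theorem mersenne_primover_iff (n : ℕ) (hn : 1 < n) (h : Primover2 n) :
    Primover2 (2 ^ n - 1) ↔ n.Prime := by
  have hN : ∀ m : ℕ, 1 < m → 1 < 2 ^ m - 1 := by
    intro m hm
    have : 2 ^ 2 ≤ 2 ^ m := Nat.pow_le_pow_right (by norm_num) hm
    omega
  constructor
  · rintro ⟨_, h2⟩
    by_contra hp
    have hq := Nat.minFac_prime (show n ≠ 1 by omega)
    have hlt : n.minFac < n := (Nat.not_prime_iff_minFac_lt hn).1 hp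
    have hd : 2 ^ n.minFac - 1 ∣ 2 ^ n - 1 :=
      Nat.pow_sub_one_dvd_pow_sub_one 2 (Nat.minFac_dvd n)
    have he := h2 _ hd (hN _ hq.one_lt)
    have h3 : (2 : ZMod (2 ^ n.minFac - 1)) ^ n.minFac = 1 :=
      (pow_eq_one_iff_aux _ _).2 dvd_rfl
    have h4 : (2 : ZMod (2 ^ n - 1)) ^ n.minFac = 1 := by
      rw [← orderOf_dvd_iff_pow_eq_one, ← he]
      exact orderOf_dvd_of_pow_eq_one h3
    rw [pow_eq_one_iff_aux] at h4
    have h5 := Nat.le_of_dvd (by have := hN _ hq.one_lt; omega) h4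
    have h6 : 2 ^ n.minFac < 2 ^ n := Nat.pow_lt_pow_right (by norm_num) hlt
    have h7 : 0 < 2 ^ n.minFac := by positivity
    omega
  · intro hp
    have key : ∀ d, d ∣ 2 ^ n - 1 → 1 < d → orderOf (2 : ZMod d) = n := by
      intro d hd h1
      have h3 : orderOf (2 : ZMod d) ∣ n :=
        orderOf_dvd_of_pow_eq_one ((pow_eq_one_iff_aux _ _).2 hd)
      rcases (Nat.dvd_prime hp).1 h3 with h4 | h4
      · have h5 := pow_orderOf_eq_one (2 : ZMod d)
        rw [h4, pow_eq_one_iff_aux] at h5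
        have := Nat.le_of_dvd (by norm_num) h5
        omega
      · exact h4
    refine ⟨hN n hn, fun d hd h1 => ?_⟩
    rw [key d hd h1, key _ dvd_rfl (hN n hn)]
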